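/- Let I = [t₀, t₁], J = I × T², let A : J → R² be smooth, and let K : [t₀,t₁) × T² → (0,∞) be a smooth positive solution of the backwards heat equation (∂_t + Δ)K = 0. If φ : J → C solves (∂_t − D_A^j D_{A,j}) φ = G with φ(t₀) given, then the energy estimate ‖K^{1/2} φ‖_{L^∞_t L²_x(J)} + ‖K^{1/2} D_A φ‖_{L²_t L²_x(J)} ≤ C ( ‖K^{1/2}(t₀) φ(t₀)‖_{L²_x} + ‖K^{1/2} G‖_{L¹_t L²_x(J)} ) holds with an absolute constant C (independent of A and K). -/

import Mathlib

noncomputable section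
open MeasureTheory

variable {F : Type*} [NormedAddCommGroup F] [NormedSpace ℝ F]

/-- Spatial partial derivative `∂_j` on space-time `ℝ × ℝ²`. -/
def pd (j : Fin 2) (f : ℝ × EuclideanSpace ℝ (Fin 2) → F) :
    ℝ × EuclideanSpace ℝ (Fin 2) → F :=
  fun z => fderiv ℝ f z (0, EuclideanSpace.single j 1)

/-- Time derivative `∂_t` on space-time. -/
def td (f : ℝ × EuclideanSpace ℝ (Fin 2) → F) :
    ℝ × EuclideanSpace ℝ (Fin 2) → F :=
  fun z => fderiv ℝ f z (1, 0)

/-- Spatial Laplacian `Δ = Σ_j ∂_j ∂_j` on space-time. -/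
def lap2 (f : ℝ × EuclideanSpace ℝ (Fin 2) → F) :
    ℝ × EuclideanSpace ℝ (Fin 2) → F :=
  fun z => ∑ j : Fin 2, pd j (pd j f) z

/-- Spatial covariant derivative `D_{A,j} f = ∂_j f + i A_j f` on space-time. -/
def cD (A : ℝ × EuclideanSpace ℝ (Fin 2) → Fin 2 → ℝ) (j : Fin 2)
    (f : ℝ × EuclideanSpace ℝ (Fin 2) → ℂ) : ℝ × EuclideanSpace ℝ (Fin 2) → ℂ :=
  fun z => pd j f z + Complex.I * (A z j : ℂ) * f z

/-- Covariant Laplacian `D_A^j D_{A,j}` on space-time. -/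
def cLap2 (A : ℝ × EuclideanSpace ℝ (Fin 2) → Fin 2 → ℝ)
    (f : ℝ × EuclideanSpace ℝ (Fin 2) → ℂ) : ℝ × EuclideanSpace ℝ (Fin 2) → ℂ :=
  fun z => ∑ j : Fin 2, cD A j (cD A j f) z

/-- A fundamental domain of the torus `T²` inside `ℝ²`. -/
def cell : Set (EuclideanSpace ℝ (Fin 2)) :=
  {x | ∀ j : Fin 2, x j ∈ Set.Ioc (0 : ℝ) (2 * Real.pi)}

local notation "E2" => EuclideanSpace ℝ (Fin 2)

/-- parametrization of the plane. -/
def par (p : ℝ × ℝ) : E2 := WithLp.toLp 2 ![p.1, p.2]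

lemma par_cd : ContDiff ℝ (⊤ : ℕ∞) par := by
  unfold par
  rw [contDiff_euclidean]
  intro i
  fin_cases i
  · exact contDiff_fst
  · exact contDiff_snd

lemma par_mp : MeasurePreserving par (volume : Measure (ℝ × ℝ)) volume := by
  have h1 := (volume_preserving_finTwoArrow ℝ).symm
  exact (PiLp.volume_preserving_toLp (Fin 2)).comp h1

lemma par_emb : MeasurableEmbedding par := by
  have h1 := (MeasurableEquiv.finTwoArrow (α := ℝ)).symm.measurableEmbedding
  exact (MeasurableEquiv.toLp 2 (Fin 2 → ℝ)).measurableEmbedding.comp h1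

lemma par_pre : par ⁻¹' cell = Set.Ioc 0 (2 * Real.pi) ×ˢ Set.Ioc 0 (2 * Real.pi) := by
  ext p
  simp [par, cell, Fin.forall_fin_two]

lemma cell_int (f : E2 → ℝ) : ∫ x in cell, f x =
    ∫ p in Set.Icc ((0 : ℝ), (0 : ℝ)) (2 * Real.pi, 2 * Real.pi), f (par p) := by
  rw [← par_mp.setIntegral_preimage_emb par_emb, par_pre]
  apply setIntegral_congr_set
  rw [← Set.Icc_prod_Icc]
  exact Measure.set_prod_ae_eq Ioc_ae_eq_Icc Ioc_ae_eq_Icc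

lemma cell_meas : MeasurableSet cell := by
  have : cell = ⋂ j : Fin 2, (fun x : E2 => x j) ⁻¹' Set.Ioc (0 : ℝ) (2 * Real.pi) := by
    ext x; simp [cell]
  rw [this]
  refine MeasurableSet.iInter fun j => ?_
  have : Measurable (fun x : E2 => x j) := by fun_prop
  exact this measurableSet_Ioc

/-- compact set containing the cell. -/
def ccell : Set E2 := par '' Set.Icc ((0 : ℝ), (0 : ℝ)) (2 * Real.pi, 2 * Real.pi)

lemma ccell_cpt : IsCompact ccell := isCompact_Icc.image par_cd.continuous

lemma cell_sub : cell ⊆ ccell := by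
  intro x hx
  refine ⟨(x 0, x 1), ?_, ?_⟩
  · have h0 := hx 0
    have h1 := hx 1
    simp only [Set.mem_Ioc] at h0 h1
    simp [h0.1.le, h0.2, h1.1.le, h1.2]
  · ext i
    fin_cases i <;> simp [par]

lemma cell_fin : volume cell < ⊤ :=
  lt_of_le_of_lt (measure_mono cell_sub) ccell_cpt.measure_lt_top

instance : IsFiniteMeasure ((volume : Measure E2).restrict cell) :=
  ⟨by rw [Measure.restrict_apply_univ]; exact cell_fin⟩

lemma slice_cont {G' : Type*} [TopologicalSpace G'] {t₁ : ℝ} {f : ℝ × E2 → G'}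
    (hf : ContinuousOn f (Set.Iio t₁ ×ˢ Set.univ))
    {t : ℝ} (ht : t < t₁) : Continuous (fun x => f (t, x)) := by
  rw [← continuousOn_univ]
  exact hf.comp (by fun_prop) (fun x _ => ⟨ht, trivial⟩)

lemma slice_int {t₁ : ℝ} {f : ℝ × E2 → ℝ} (hf : ContinuousOn f (Set.Iio t₁ ×ˢ Set.univ))
    {t : ℝ} (ht : t < t₁) : IntegrableOn (fun x => f (t, x)) cell :=
  ((slice_cont hf ht).continuousOn.integrableOn_compact ccell_cpt).mono_set cell_sub

lemma loc_bound {t₁ : ℝ} {f : ℝ × E2 → ℝ} (hf : ContinuousOn f (Set.Iio t₁ ×ˢ Set.univ))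
    {t : ℝ} (ht : t < t₁) : ∃ s ∈ nhds t, ∃ M : ℝ, s ⊆ Set.Iio t₁ ∧
      ∀ r ∈ s, ∀ x ∈ cell, ‖f (r, x)‖ ≤ M := by
  obtain ⟨u, hu, hu'⟩ := exists_between ht
  have hc : IsCompact (Set.Icc (t - 1) u ×ˢ ccell) := isCompact_Icc.prod ccell_cpt
  obtain ⟨M, hM⟩ := hc.exists_bound_of_continuousOn
    (hf.mono (Set.prod_mono (fun r hr => lt_of_le_of_lt hr.2 hu') (Set.subset_univ _)))
  exact ⟨Set.Icc (t - 1) u, Icc_mem_nhds (by linarith) hu, M, fun r hr => lt_of_le_of_lt hr.2 hu',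
    fun r hr x hx => hM (r, x) ⟨hr, cell_sub hx⟩⟩

lemma param_cont {t₁ : ℝ} {f : ℝ × E2 → ℝ} (hf : ContinuousOn f (Set.Iio t₁ ×ˢ Set.univ)) :
    ContinuousOn (fun t => ∫ x in cell, f (t, x)) (Set.Iio t₁) := by
  intro t ht
  apply ContinuousAt.continuousWithinAt
  obtain ⟨s, hs, M, hst, hM⟩ := loc_bound hf ht
  apply continuousAt_of_dominated (bound := fun _ => M)
  · filter_upwards [hs] with r hr
    exact (slice_cont hf (hst hr)).aestronglyMeasurable
  · filter_upwards [hs] with r hr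
    exact (ae_restrict_iff' cell_meas).2 (Filter.Eventually.of_forall fun x hx => hM r hr x hx)
  · exact integrable_const _
  · refine Filter.Eventually.of_forall fun x => ?_
    have : ContinuousAt f (t, x) :=
      hf.continuousAt ((isOpen_Iio.prod isOpen_univ).mem_nhds ⟨ht, trivial⟩)
    exact ContinuousAt.comp (f := fun r : ℝ => (r, x)) this (by fun_prop)

lemma fderiv_cdo {H : Type*} [NormedAddCommGroup H] [NormedSpace ℝ H]
    {t₁ : ℝ} {f : ℝ × E2 → H}
    (hf : ContDiffOn ℝ (⊤ : ℕ∞) f (Set.Iio t₁ ×ˢ Set.univ)) (v : ℝ × E2) :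
    ContDiffOn ℝ (⊤ : ℕ∞) (fun z => fderiv ℝ f z v) (Set.Iio t₁ ×ˢ Set.univ) :=
  (hf.fderiv_of_isOpen (isOpen_Iio.prod isOpen_univ) (by simp)).clm_apply contDiffOn_const

lemma cdo_diff {H : Type*} [NormedAddCommGroup H] [NormedSpace ℝ H]
    {t₁ : ℝ} {f : ℝ × E2 → H}
    (hf : ContDiffOn ℝ (⊤ : ℕ∞) f (Set.Iio t₁ ×ˢ Set.univ)) {z : ℝ × E2} (hz : z.1 < t₁) :
    DifferentiableAt ℝ f z :=
  (hf.contDiffAt ((isOpen_Iio.prod isOpen_univ).mem_nhds ⟨hz, trivial⟩)).differentiableAt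
    (by simp)

lemma param_deriv {t₁ : ℝ} {f : ℝ × E2 → ℝ}
    (hf : ContDiffOn ℝ (⊤ : ℕ∞) f (Set.Iio t₁ ×ˢ Set.univ)) {t : ℝ} (ht : t < t₁) :
    HasDerivAt (fun t => ∫ x in cell, f (t, x)) (∫ x in cell, td f (t, x)) t := by
  have hd : ContinuousOn (td f) (Set.Iio t₁ ×ˢ Set.univ) := (fderiv_cdo hf (1, 0)).continuousOn
  obtain ⟨s, hs, M, hst, hM⟩ := loc_bound hd ht
  refine (hasDerivAt_integral_of_dominated_loc_of_deriv_le (bound := fun _ => M)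
    (F := fun t x => f (t, x)) (F' := fun t x => td f (t, x)) hs ?_ ?_ ?_ ?_ ?_ ?_).2
  · filter_upwards [hs] with r hr
    exact (slice_cont hf.continuousOn (hst hr)).aestronglyMeasurable
  · exact slice_int hf.continuousOn ht
  · exact (slice_cont hd ht).aestronglyMeasurable
  · exact (ae_restrict_iff' cell_meas).2
      (Filter.Eventually.of_forall fun x hx r hr => hM r hr x hx)
  · exact integrable_const _
  · refine Filter.Eventually.of_forall fun x r hr => ?_
    have h1 := (cdo_diff hf (z := (r, x)) (hst hr)).hasFDerivAt
    have h2 : HasDerivAt (fun r : ℝ => (r, x)) ((1 : ℝ), (0 : E2)) r :=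
      (hasDerivAt_id r).prodMk (hasDerivAt_const r x)
    exact h1.comp_hasDerivAt r h2

lemma int_pd {t₁ : ℝ} {f : ℝ × E2 → ℝ}
    (hf : ContDiffOn ℝ (⊤ : ℕ∞) f (Set.Iio t₁ ×ˢ Set.univ)) {t : ℝ} (ht : t < t₁)
    (hp : ∀ (x : E2) (k : Fin 2), f (t, x + EuclideanSpace.single k (2 * Real.pi)) = f (t, x))
    (j : Fin 2) : ∫ x in cell, pd j f (t, x) = 0 := by
  rw [cell_int]
  have hpi := Real.pi_pos
  let g : ℝ × ℝ → ℝ := fun p => f (t, par p)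
  have hg : ContDiff ℝ (⊤ : ℕ∞) g := by
    rw [← contDiffOn_univ]
    exact hf.comp (contDiff_const.prodMk par_cd).contDiffOn (fun x _ => ⟨ht, trivial⟩)
  have hgd : Differentiable ℝ g := hg.differentiable (by simp)
  have hgf : ∀ p v, fderiv ℝ g p v = fderiv ℝ f (t, par p) (0, par v) := by
    intro p v
    have h1 := (cdo_diff hf (z := (t, par p)) ht).hasFDerivAt
    have h2 : HasDerivAt (fun r : ℝ => (t, par (p + r • v))) ((0 : ℝ), par v) 0 := by
      refine (hasDerivAt_const 0 t).prodMk ?_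
      have : (fun r : ℝ => par (p + r • v)) = fun r : ℝ => par p + r • par v := by
        ext r i
        fin_cases i <;> simp [par]
      rw [this]
      simpa using ((hasDerivAt_id (0 : ℝ)).smul_const (par v)).const_add (par p)
    have h3 : HasDerivAt (fun r : ℝ => p + r • v) v 0 := by
      simpa using ((hasDerivAt_id (0 : ℝ)).smul_const v).const_add p
    have h4 : HasDerivAt (fun r : ℝ => g (p + r • v)) (fderiv ℝ g p v) 0 := by
      have := (hgd p).hasFDerivAt
      exact HasFDerivAt.comp_hasDerivAt (f := fun r : ℝ => p + r • v) (0 : ℝ)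
        (by simpa using this) h3
    have h5 : HasDerivAt (fun r : ℝ => g (p + r • v)) (fderiv ℝ f (t, par p) (0, par v)) 0 :=
      HasFDerivAt.comp_hasDerivAt (f := fun r : ℝ => (t, par (p + r • v))) (0 : ℝ)
        (by simpa using h1) h2
    exact h4.unique h5
  have hle : ((0 : ℝ), (0 : ℝ)) ≤ (2 * Real.pi, 2 * Real.pi) :=
    ⟨by simpa using hpi.le, by simpa using hpi.le⟩
  have hci : ∀ v, IntegrableOn (fun p => fderiv ℝ g p v)
      (Set.Icc ((0 : ℝ), (0 : ℝ)) (2 * Real.pi, 2 * Real.pi)) := fun v =>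
    ((hg.continuous_fderiv (by simp)).clm_apply continuous_const).continuousOn.integrableOn_compact
      isCompact_Icc
  fin_cases j
  · have := integral_divergence_prod_Icc_of_hasFDerivAt_of_le g 0 (fun p => fderiv ℝ g p) 0
      (0, 0) (2 * Real.pi, 2 * Real.pi) hle hg.continuous.continuousOn continuousOn_const
      (fun x _ => (hgd x).hasFDerivAt) (fun x _ => hasFDerivAt_const _ _)
      (by simpa using hci (1, 0))
    have hb : ∀ y, g (2 * Real.pi, y) = g (0, y) := by
      intro y
      have := hp (par (0, y)) 0
      convert this using 3
      ext i
      fin_cases i <;> simp [par]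
    have e : par (1, 0) = EuclideanSpace.single 0 1 := by
      ext i
      fin_cases i <;> simp [par]
    simp [hb, hgf, e] at this
    simpa [pd] using this
  · have := integral_divergence_prod_Icc_of_hasFDerivAt_of_le 0 g 0 (fun p => fderiv ℝ g p)
      (0, 0) (2 * Real.pi, 2 * Real.pi) hle continuousOn_const hg.continuous.continuousOn
      (fun x _ => hasFDerivAt_const _ _) (fun x _ => (hgd x).hasFDerivAt)
      (by simpa using hci (0, 1))
    have hb : ∀ y, g (y, 2 * Real.pi) = g (y, 0) := by
      intro y
      have := hp (par (y, 0)) 1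
      convert this using 3
      ext i
      fin_cases i <;> simp [par]
    have e : par (0, 1) = EuclideanSpace.single 1 1 := by
      ext i
      fin_cases i <;> simp [par]
    simp [hb, hgf, e] at this
    simpa [pd] using this

/-- spatial periodicity. -/
def Per {H : Type*} (f : ℝ × E2 → H) : Prop :=
  ∀ (z : ℝ × E2) (k : Fin 2), f (z.1, z.2 + EuclideanSpace.single k (2 * Real.pi)) = f z

lemma Per.pd {H : Type*} [NormedAddCommGroup H] [NormedSpace ℝ H] {f : ℝ × E2 → H}
    (hf : Per f) (j : Fin 2) : Per (pd j f) := by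
  intro z k
  have h : (fun w => f (w + ((0 : ℝ), EuclideanSpace.single k (2 * Real.pi)))) = f := by
    ext w
    have := hf w k
    rw [← this]
    congr 1
    ext <;> simp
  have h2 := fderiv_comp_add_right (𝕜 := ℝ) (f := f) (x := z)
    ((0 : ℝ), EuclideanSpace.single k (2 * Real.pi))
  rw [h] at h2
  have h3 : z + ((0 : ℝ), EuclideanSpace.single k (2 * Real.pi)) =
    (z.1, z.2 + EuclideanSpace.single k (2 * Real.pi)) := by ext <;> simp
  rw [h3] at h2
  simp only [_root_.pd, h2]

lemma cD_cd {A : ℝ × E2 → Fin 2 → ℝ} {φ : ℝ × E2 → ℂ} (hA : ContDiff ℝ (⊤ : ℕ∞) A)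
    (hφ : ContDiff ℝ (⊤ : ℕ∞) φ) (j : Fin 2) : ContDiff ℝ (⊤ : ℕ∞) (cD A j φ) := by
  have h1 : ContDiff ℝ (⊤ : ℕ∞) (pd j φ) :=
    (hφ.fderiv_right (by simp)).clm_apply contDiff_const
  have h2 : ContDiff ℝ (⊤ : ℕ∞) (fun z => (A z j : ℂ)) :=
    Complex.ofRealCLM.contDiff.comp (contDiff_pi.1 hA j)
  exact h1.add ((contDiff_const.mul h2).mul hφ)

lemma Per.cD {A : ℝ × E2 → Fin 2 → ℝ} {φ : ℝ × E2 → ℂ}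
    (hA : ∀ (z : ℝ × E2) (j k : Fin 2),
          A (z.1, z.2 + EuclideanSpace.single k (2 * Real.pi)) j = A z j)
    (hφ : Per φ) (j : Fin 2) : Per (cD A j φ) := by
  intro z k
  simp only [_root_.cD, hA, hφ z k, hφ.pd j z k]

/-- the flux. -/
def flux (A : ℝ × E2 → Fin 2 → ℝ) (φ : ℝ × E2 → ℂ) (K : ℝ × E2 → ℝ) (j : Fin 2) :
    ℝ × E2 → ℝ :=
  fun z => K z * (2 * inner ℝ (φ z) (cD A j φ z)) - inner ℝ (φ z) (φ z) * pd j K z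

lemma pd_flux {t₁ : ℝ} {A : ℝ × E2 → Fin 2 → ℝ} {φ : ℝ × E2 → ℂ} {K : ℝ × E2 → ℝ}
    (hA : ContDiff ℝ (⊤ : ℕ∞) A) (hφ : ContDiff ℝ (⊤ : ℕ∞) φ)
    (hK : ContDiffOn ℝ (⊤ : ℕ∞) K (Set.Iio t₁ ×ˢ Set.univ)) (j : Fin 2)
    {z : ℝ × E2} (hz : z.1 < t₁) :
    pd j (flux A φ K j) z = 2 * K z * inner ℝ (φ z) (cD A j (cD A j φ) z)
      + 2 * (K z * ‖cD A j φ z‖ ^ 2) - ‖φ z‖ ^ 2 * pd j (pd j K) z := by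
  have dK := cdo_diff hK hz
  have dK' : DifferentiableAt ℝ (pd j K) z := cdo_diff (fderiv_cdo hK _) hz
  have dφ : DifferentiableAt ℝ φ z := hφ.differentiable (by simp) z
  have dD : DifferentiableAt ℝ (cD A j φ) z := (cD_cd hA hφ j).differentiable (by simp) z
  have d1 := dφ.inner ℝ dD
  have d2 := dφ.inner ℝ dφ
  have h : pd j (flux A φ K j) z =
      K z * (2 * (inner ℝ (φ z) (pd j (cD A j φ) z) + inner ℝ (pd j φ z) (cD A j φ z)))
      + 2 * inner ℝ (φ z) (cD A j φ z) * pd j K z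
      - (inner ℝ (φ z) (φ z) * pd j (pd j K) z
        + pd j K z * (inner ℝ (φ z) (pd j φ z) + inner ℝ (pd j φ z) (φ z))) := by
    change fderiv ℝ (flux A φ K j) z (0, EuclideanSpace.single j 1) = _
    unfold flux
    have m1 : DifferentiableAt ℝ (fun z => K z * (2 * inner ℝ (φ z) (cD A j φ z))) z :=
      dK.mul (d1.const_mul 2)
    have m2 : DifferentiableAt ℝ (fun z => inner ℝ (φ z) (φ z) * pd j K z) z := d2.mul dK'
    rw [fderiv_fun_sub m1 m2,
      fderiv_fun_mul dK (d1.const_mul 2), fderiv_fun_mul d2 dK', fderiv_const_mul d1 2]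
    simp only [sub_apply, add_apply,
      smul_apply, smul_eq_mul]
    rw [fderiv_inner_apply ℝ dφ dD, fderiv_inner_apply ℝ dφ dφ]
    simp only [pd]
  rw [h]
  have e1 : pd j (cD A j φ) z = cD A j (cD A j φ) z - Complex.I * (A z j : ℂ) * cD A j φ z := by
    change _ = pd j (cD A j φ) z + Complex.I * (A z j : ℂ) * cD A j φ z - _
    rw [add_sub_cancel_right]
  have e2 : pd j φ z = cD A j φ z - Complex.I * (A z j : ℂ) * φ z := by
    simp [cD]
  rw [e1, e2]
  generalize cD A j (cD A j φ) z = a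
  generalize cD A j φ z = b
  rw [← Complex.normSq_eq_norm_sq, ← Complex.normSq_eq_norm_sq]
  rw [Complex.inner, Complex.inner, Complex.inner, Complex.inner, Complex.inner, Complex.inner, Complex.inner]
  simp only [Complex.normSq_apply, Complex.mul_re, Complex.mul_im, Complex.sub_re, Complex.sub_im,
    Complex.conj_re, Complex.conj_im, Complex.I_re, Complex.I_im, Complex.ofReal_re,
    Complex.ofReal_im]
  ring

lemma td_en {t₁ : ℝ} {φ : ℝ × E2 → ℂ} {K : ℝ × E2 → ℝ}
    (hφ : ContDiff ℝ (⊤ : ℕ∞) φ)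
    (hK : ContDiffOn ℝ (⊤ : ℕ∞) K (Set.Iio t₁ ×ˢ Set.univ))
    {z : ℝ × E2} (hz : z.1 < t₁) :
    td (fun z => K z * ‖φ z‖ ^ 2) z = td K z * ‖φ z‖ ^ 2 + 2 * K z * inner ℝ (φ z) (td φ z) := by
  have dK := cdo_diff hK hz
  have dφ : DifferentiableAt ℝ φ z := hφ.differentiable (by simp) z
  have d2 := dφ.inner ℝ dφ
  have e : (fun z => K z * ‖φ z‖ ^ 2) = fun z => K z * inner ℝ (φ z) (φ z) := by
    ext w; rw [real_inner_self_eq_norm_sq]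
  rw [e]
  conv_lhs => unfold td
  rw [fderiv_fun_mul dK d2]
  simp only [add_apply, smul_apply, smul_eq_mul]
  rw [fderiv_inner_apply ℝ dφ dφ, real_inner_comm (φ z), real_inner_self_eq_norm_sq]
  simp only [td]
  rw [real_inner_comm]
  ring

lemma cauchy {t₁ : ℝ} {φ G : ℝ × E2 → ℂ} {K : ℝ × E2 → ℝ}
    (hφ : Continuous φ) (hG : Continuous G)
    (hK : ContinuousOn K (Set.Iio t₁ ×ˢ Set.univ)) {t : ℝ} (ht : t < t₁)
    (hpos : ∀ x, 0 < K (t, x)) :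
    ∫ x in cell, K (t, x) * inner ℝ (φ (t, x)) (G (t, x)) ≤
      Real.sqrt (∫ x in cell, K (t, x) * ‖φ (t, x)‖ ^ 2) *
      Real.sqrt (∫ x in cell, K (t, x) * ‖G (t, x)‖ ^ 2) := by
  have i1 : IntegrableOn (fun x => K (t, x) * ‖φ (t, x)‖ ^ 2) cell :=
    slice_int (f := fun z => K z * ‖φ z‖ ^ 2) (hK.mul (by fun_prop)) ht
  have i2 : IntegrableOn (fun x => K (t, x) * ‖G (t, x)‖ ^ 2) cell :=
    slice_int (f := fun z => K z * ‖G z‖ ^ 2) (hK.mul (by fun_prop)) ht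
  have i3 : IntegrableOn (fun x => K (t, x) * inner ℝ (φ (t, x)) (G (t, x))) cell :=
    slice_int (f := fun z => K z * inner ℝ (φ z) (G z))
      (hK.mul (hφ.inner hG).continuousOn) ht
  set a := ∫ x in cell, K (t, x) * ‖φ (t, x)‖ ^ 2
  set c := ∫ x in cell, K (t, x) * ‖G (t, x)‖ ^ 2
  set b := ∫ x in cell, K (t, x) * inner ℝ (φ (t, x)) (G (t, x))
  have ha : 0 ≤ a := integral_nonneg fun x => mul_nonneg (hpos x).le (by positivity)
  have hq : ∀ s : ℝ, 0 ≤ a * (s * s) + (2 * b) * s + c := by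
    intro s
    have : ∫ x in cell, K (t, x) * ‖s • φ (t, x) + G (t, x)‖ ^ 2 =
        a * (s * s) + (2 * b) * s + c := by
      have e : ∀ x, K (t, x) * ‖s • φ (t, x) + G (t, x)‖ ^ 2 =
        (s * s) * (K (t, x) * ‖φ (t, x)‖ ^ 2) +
        (2 * s) * (K (t, x) * inner ℝ (φ (t, x)) (G (t, x))) + K (t, x) * ‖G (t, x)‖ ^ 2 := by
        intro x
        rw [norm_add_sq_real, norm_smul, real_inner_smul_left, mul_pow, Real.norm_eq_abs, sq_abs]
        ring
      simp only [e]
      have j1 : IntegrableOn (fun x => (s * s) * (K (t, x) * ‖φ (t, x)‖ ^ 2) +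
        (2 * s) * (K (t, x) * inner ℝ (φ (t, x)) (G (t, x)))) cell :=
        (i1.const_mul _).add (i3.const_mul _)
      rw [integral_add j1 i2,
        integral_add (i1.const_mul _) (i3.const_mul _), integral_const_mul, integral_const_mul]
      ring
    rw [← this]
    exact integral_nonneg fun x => mul_nonneg (hpos x).le (by positivity)
  have hd := discrim_le_zero hq
  rw [discrim] at hd
  rw [← Real.sqrt_mul ha]
  exact Real.le_sqrt_of_sq_le (by nlinarith)

/-- bound via conserved mass. -/
lemma mass_bound {t₀ t₁ : ℝ} {K : ℝ × E2 → ℝ} (h01 : t₀ < t₁)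
    (hK : ContDiffOn ℝ (⊤ : ℕ∞) K (Set.Iio t₁ ×ˢ Set.univ)) (hKp : Per K)
    (hpos : ∀ z : ℝ × E2, z.1 ∈ Set.Ico t₀ t₁ → 0 < K z)
    (hheat : ∀ z : ℝ × E2, z.1 ∈ Set.Ico t₀ t₁ → td K z + lap2 K z = 0)
    {f : ℝ × E2 → ℝ} (hf : Continuous f) :
    ∃ M : ℝ, 0 ≤ M ∧ ∀ t ∈ Set.Ico t₀ t₁, ∫ x in cell, K (t, x) * f (t, x) ≤ M := by
  have hmass : ∀ t ∈ Set.Ico t₀ t₁, ∫ x in cell, K (t, x) = ∫ x in cell, K (t₀, x) := by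
    intro t ht
    have hder : ∀ s ∈ Set.Ico t₀ t₁, HasDerivAt (fun t => ∫ x in cell, K (t, x)) 0 s := by
      intro s hs
      have h := param_deriv hK hs.2
      have e : ∫ x in cell, td K (s, x) = 0 := by
        have : ∀ x, td K (s, x) = - pd 0 (pd 0 K) (s, x) - pd 1 (pd 1 K) (s, x) := by
          intro x
          have := hheat (s, x) hs
          simp only [lap2, Fin.sum_univ_two] at this
          linarith
        simp only [this]
        have hp : ∀ j, ContDiffOn ℝ (⊤ : ℕ∞) (pd j K) (Set.Iio t₁ ×ˢ Set.univ) :=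
          fun j => fderiv_cdo hK _
        have hi : ∀ j, IntegrableOn (fun x => pd j (pd j K) (s, x)) cell := fun j =>
          slice_int (f := pd j (pd j K)) (fderiv_cdo (hp j) _).continuousOn hs.2
        have hn : IntegrableOn (fun x => - pd 0 (pd 0 K) (s, x)) cell := (hi 0).neg
        rw [integral_sub hn (hi 1), integral_neg,
          int_pd (hp 0) hs.2 (fun x k => hKp.pd 0 (s, x) k),
          int_pd (hp 1) hs.2 (fun x k => hKp.pd 1 (s, x) k)]
        simp
      rwa [e] at h
    refine constant_of_has_deriv_right_zero (f := fun t => ∫ x in cell, K (t, x))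
      (a := t₀) (b := t) ?_ ?_ t ⟨ht.1, le_rfl⟩
    · exact fun s hs => (hder s ⟨hs.1, lt_of_le_of_lt hs.2 ht.2⟩).continuousAt.continuousWithinAt
    · exact fun s hs => (hder s ⟨hs.1, hs.2.trans ht.2⟩).hasDerivWithinAt
  obtain ⟨B, hB⟩ := (isCompact_Icc.prod ccell_cpt : IsCompact (Set.Icc t₀ t₁ ×ˢ ccell))
    |>.exists_bound_of_continuousOn hf.continuousOn
  have hm0 : 0 ≤ ∫ x in cell, K (t₀, x) :=
    integral_nonneg fun x => (hpos (t₀, x) ⟨le_rfl, h01⟩).le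
  refine ⟨|B| * ∫ x in cell, K (t₀, x), by positivity, fun t ht => ?_⟩
  rw [← hmass t ht, ← integral_const_mul]
  refine setIntegral_mono_on (slice_int (f := fun z => K z * f z)
    (hK.continuousOn.mul hf.continuousOn) ht.2)
    ((slice_int hK.continuousOn ht.2).const_mul _) cell_meas fun x hx => ?_
  have h1 := hB (t, x) ⟨⟨ht.1, ht.2.le⟩, cell_sub hx⟩
  have h2 := hpos (t, x) ht
  have : f (t, x) ≤ |B| := (le_abs_self _).trans (h1.trans (le_abs_self _))
  nlinarith

lemma int_bdd {t₀ t₁ M : ℝ} {d : ℝ → ℝ} (hd : ContinuousOn d (Set.Iio t₁))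
    (h0 : ∀ t ∈ Set.Ico t₀ t₁, 0 ≤ d t) (hM : ∀ t ∈ Set.Ico t₀ t₁, d t ≤ M) :
    IntegrableOn d (Set.Ico t₀ t₁) := by
  refine Integrable.of_bound (C := M)
    ((hd.mono fun t ht => ht.2).aestronglyMeasurable measurableSet_Ico) ?_
  refine (ae_restrict_iff' measurableSet_Ico).2 (Filter.Eventually.of_forall fun t ht => ?_)
  rw [Real.norm_eq_abs, abs_of_nonneg (h0 t ht)]
  exact hM t ht

lemma real_est {t₀ t₁ Me Md Mg : ℝ} (h01 : t₀ < t₁) {e d g e' : ℝ → ℝ}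
    (he : ∀ t ∈ Set.Ico t₀ t₁, HasDerivAt e (e' t) t)
    (hce' : ContinuousOn e' (Set.Iio t₁)) (hcd : ContinuousOn d (Set.Iio t₁))
    (hcg : ContinuousOn g (Set.Iio t₁))
    (e0 : ∀ t ∈ Set.Ico t₀ t₁, 0 ≤ e t) (d0 : ∀ t ∈ Set.Ico t₀ t₁, 0 ≤ d t)
    (g0 : ∀ t ∈ Set.Ico t₀ t₁, 0 ≤ g t)
    (eM : ∀ t ∈ Set.Ico t₀ t₁, e t ≤ Me) (dM : ∀ t ∈ Set.Ico t₀ t₁, d t ≤ Md)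
    (gM : ∀ t ∈ Set.Ico t₀ t₁, g t ≤ Mg)
    (hin : ∀ t ∈ Set.Ico t₀ t₁, e' t ≤ -2 * d t + 2 * (Real.sqrt (e t) * g t)) :
    (⨆ t : Set.Ico t₀ t₁, Real.sqrt (e t)) + Real.sqrt (∫ t in Set.Ico t₀ t₁, d t) ≤
      4 * (Real.sqrt (e t₀) + ∫ t in Set.Ico t₀ t₁, g t) := by
  have idd := int_bdd hcd d0 dM
  have ig := int_bdd hcg g0 gM
  have m0 : t₀ ∈ Set.Ico t₀ t₁ := ⟨le_rfl, h01⟩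
  have : Nonempty (Set.Ico t₀ t₁) := ⟨⟨t₀, m0⟩⟩
  have hbdd : BddAbove (Set.range fun t : Set.Ico t₀ t₁ => Real.sqrt (e t)) := by
    refine ⟨Real.sqrt Me, ?_⟩
    rintro _ ⟨t, rfl⟩
    exact Real.sqrt_le_sqrt (eM t t.2)
  set S := ⨆ t : Set.Ico t₀ t₁, Real.sqrt (e t) with hS
  set N := ∫ t in Set.Ico t₀ t₁, g t with hN
  set a := Real.sqrt (e t₀) with ha
  have ha0 : 0 ≤ a := Real.sqrt_nonneg _
  have hN0 : 0 ≤ N := setIntegral_nonneg measurableSet_Ico g0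
  have hle : ∀ t ∈ Set.Ico t₀ t₁, Real.sqrt (e t) ≤ S := fun t ht => le_ciSup hbdd ⟨t, ht⟩
  have hS0 : 0 ≤ S := (Real.sqrt_nonneg _).trans (hle t₀ m0)
  have ha2 : a ^ 2 = e t₀ := Real.sq_sqrt (e0 t₀ m0)
  have key : ∀ T ∈ Set.Ico t₀ t₁, e T + 2 * ∫ t in t₀..T, d t ≤ a ^ 2 + 2 * (S * N) := by
    intro T hT
    have hsub : Set.Icc t₀ T ⊆ Set.Ico t₀ t₁ := fun t ht => ⟨ht.1, lt_of_le_of_lt ht.2 hT.2⟩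
    have hsub' : Set.uIcc t₀ T ⊆ Set.Iio t₁ := by
      rw [Set.uIcc_of_le hT.1]
      exact fun t ht => lt_of_le_of_lt ht.2 hT.2
    have i1 : IntervalIntegrable e' volume t₀ T := (hce'.mono hsub').intervalIntegrable
    have i2 : IntervalIntegrable d volume t₀ T := (hcd.mono hsub').intervalIntegrable
    have i3 : IntervalIntegrable g volume t₀ T := (hcg.mono hsub').intervalIntegrable
    have h1 : ∫ t in t₀..T, e' t = e T - e t₀ := by
      refine intervalIntegral.integral_eq_sub_of_hasDerivAt (fun t ht => ?_) i1
      rw [Set.uIcc_of_le hT.1] at ht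
      exact he t (hsub ht)
    have i4 : IntervalIntegrable (fun t => -2 * d t + (2 * S) * g t) volume t₀ T :=
      (i2.const_mul _).add (i3.const_mul _)
    have h2 : ∫ t in t₀..T, e' t ≤ ∫ t in t₀..T, (-2 * d t + (2 * S) * g t) := by
      refine intervalIntegral.integral_mono_on hT.1 i1 i4 fun t ht => ?_
      have := hin t (hsub ht)
      have h3 := mul_le_mul_of_nonneg_right (hle t (hsub ht)) (g0 t (hsub ht))
      linarith
    rw [intervalIntegral.integral_add (i2.const_mul _) (i3.const_mul _),
      intervalIntegral.integral_const_mul, intervalIntegral.integral_const_mul] at h2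
    have h4 : ∫ t in t₀..T, g t ≤ N := by
      rw [intervalIntegral.integral_of_le hT.1, ← integral_Icc_eq_integral_Ioc]
      refine setIntegral_mono_set ig ?_ hsub.eventuallyLE
      exact (ae_restrict_iff' measurableSet_Ico).2 (Filter.Eventually.of_forall g0)
    have h5 := mul_le_mul_of_nonneg_left h4 hS0
    linarith
  have hdnn : ∀ T ∈ Set.Ico t₀ t₁, 0 ≤ ∫ t in t₀..T, d t := fun T hT =>
    intervalIntegral.integral_nonneg hT.1 fun t ht => d0 t ⟨ht.1, lt_of_le_of_lt ht.2 hT.2⟩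
  have hSb : S ≤ Real.sqrt (a ^ 2 + 2 * (S * N)) := by
    refine ciSup_le fun t => Real.sqrt_le_sqrt ?_
    have := key t t.2
    have := hdnn t t.2
    linarith
  have hS2 : S ^ 2 ≤ a ^ 2 + 2 * (S * N) := by
    have := Real.sq_sqrt (show 0 ≤ a ^ 2 + 2 * (S * N) by positivity)
    rw [← this]
    gcongr
  have hSf : S ≤ a + 2 * N := by nlinarith
  have hD : 2 * ∫ t in Set.Ico t₀ t₁, d t ≤ a ^ 2 + 2 * (S * N) := by
    refine le_of_forall_pos_le_add fun ε hε => ?_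
    have hMd : 0 ≤ Md := (d0 t₀ m0).trans (dM t₀ m0)
    obtain ⟨T, hT, hT'⟩ : ∃ T ∈ Set.Ico t₀ t₁, 2 * Md * (t₁ - T) ≤ ε := by
      refine ⟨max t₀ (t₁ - ε / (2 * Md + 1)), ⟨le_max_left _ _, max_lt h01 ?_⟩, ?_⟩
      · have : 0 < ε / (2 * Md + 1) := by positivity
        linarith
      · have h1 := le_max_right t₀ (t₁ - ε / (2 * Md + 1))
        have h2 : t₁ - max t₀ (t₁ - ε / (2 * Md + 1)) ≤ ε / (2 * Md + 1) := by linarith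
        calc _ ≤ 2 * Md * (ε / (2 * Md + 1)) := by gcongr
          _ ≤ (2 * Md + 1) * (ε / (2 * Md + 1)) := by gcongr; linarith
          _ = ε := by field_simp
    have hsplit : ∫ t in Set.Ico t₀ t₁, d t =
        (∫ t in Set.Ico t₀ T, d t) + ∫ t in Set.Ico T t₁, d t := by
      rw [← Set.Ico_union_Ico_eq_Ico hT.1 hT.2.le]
      refine setIntegral_union ?_ measurableSet_Ico (idd.mono_set ?_) (idd.mono_set ?_)
      · exact Set.Ico_disjoint_Ico_same
      · exact Set.Ico_subset_Ico_right hT.2.le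
      · exact Set.Ico_subset_Ico_left hT.1
    have h1 : ∫ t in Set.Ico t₀ T, d t = ∫ t in t₀..T, d t := by
      rw [intervalIntegral.integral_of_le hT.1, ← integral_Icc_eq_integral_Ioc,
        integral_Icc_eq_integral_Ico]
    have h2 : ∫ t in Set.Ico T t₁, d t ≤ Md * (t₁ - T) := by
      have : ∫ t in Set.Ico T t₁, d t ≤ ∫ t in Set.Ico T t₁, Md :=
        setIntegral_mono_on (idd.mono_set (Set.Ico_subset_Ico_left hT.1)) (by simp)
          measurableSet_Ico fun t ht => dM t ⟨hT.1.trans ht.1, ht.2⟩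
      rw [setIntegral_const, Real.volume_real_Ico_of_le hT.2.le, smul_eq_mul] at this
      linarith
    have h3 := key T hT
    have h4 := e0 T hT
    rw [hsplit, h1]
    linarith
  have hDf : Real.sqrt (∫ t in Set.Ico t₀ t₁, d t) ≤ 2 * (a + N) := by
    rw [Real.sqrt_le_left (by positivity)]
    nlinarith
  linarith

/-- **Weighted covariant energy estimate.** Let `K` be a smooth positive solution of the
backwards heat equation `(∂_t + Δ)K = 0` on `[t₀,t₁) × T²`, and let `φ` solve
`(∂_t − D_A^j D_{A,j}) φ = G` on `J = [t₀,t₁] × T²`. Then, with an absolute constant `C`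
(independent of `A` and `K`):
`‖K^{1/2}φ‖_{L^∞_t L²_x} + ‖K^{1/2} D_A φ‖_{L²_t L²_x}
  ≤ C(‖K^{1/2}(t₀) φ(t₀)‖_{L²_x} + ‖K^{1/2} G‖_{L¹_t L²_x})`. -/
theorem weighted_covariant_energy_estimate :
    ∃ C : ℝ, 0 < C ∧
      ∀ (t₀ t₁ : ℝ), t₀ ≤ t₁ →
      ∀ (A : ℝ × EuclideanSpace ℝ (Fin 2) → Fin 2 → ℝ)
        (φ G : ℝ × EuclideanSpace ℝ (Fin 2) → ℂ)
        (K : ℝ × EuclideanSpace ℝ (Fin 2) → ℝ),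
        ContDiff ℝ (⊤ : ℕ∞) A → ContDiff ℝ (⊤ : ℕ∞) φ → ContDiff ℝ (⊤ : ℕ∞) G →
        ContDiffOn ℝ (⊤ : ℕ∞) K
          ((Set.Iio t₁) ×ˢ (Set.univ : Set (EuclideanSpace ℝ (Fin 2)))) →
        (∀ (z : ℝ × EuclideanSpace ℝ (Fin 2)) (j k : Fin 2),
          A (z.1, z.2 + EuclideanSpace.single k (2 * Real.pi)) j = A z j) →
        (∀ (z : ℝ × EuclideanSpace ℝ (Fin 2)) (k : Fin 2),
          φ (z.1, z.2 + EuclideanSpace.single k (2 * Real.pi)) = φ z) →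
        (∀ (z : ℝ × EuclideanSpace ℝ (Fin 2)) (k : Fin 2),
          G (z.1, z.2 + EuclideanSpace.single k (2 * Real.pi)) = G z) →
        (∀ (z : ℝ × EuclideanSpace ℝ (Fin 2)) (k : Fin 2),
          K (z.1, z.2 + EuclideanSpace.single k (2 * Real.pi)) = K z) →
        (∀ z : ℝ × EuclideanSpace ℝ (Fin 2), z.1 ∈ Set.Ico t₀ t₁ → 0 < K z) →
        (∀ z : ℝ × EuclideanSpace ℝ (Fin 2), z.1 ∈ Set.Ico t₀ t₁ →
          td K z + lap2 K z = 0) →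
        (∀ z : ℝ × EuclideanSpace ℝ (Fin 2), z.1 ∈ Set.Icc t₀ t₁ →
          td φ z = cLap2 A φ z + G z) →
        (⨆ t : Set.Ico t₀ t₁,
            Real.sqrt (∫ x in cell, K ((t : ℝ), x) * ‖φ ((t : ℝ), x)‖ ^ 2))
          + Real.sqrt (∫ t in Set.Ico t₀ t₁, ∫ x in cell,
              K (t, x) * ∑ j : Fin 2, ‖cD A j φ (t, x)‖ ^ 2)
        ≤ C * (Real.sqrt (∫ x in cell, K (t₀, x) * ‖φ (t₀, x)‖ ^ 2)
            + ∫ t in Set.Ico t₀ t₁,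
                Real.sqrt (∫ x in cell, K (t, x) * ‖G (t, x)‖ ^ 2)) := by
  refine ⟨4, by norm_num, ?_⟩
  intro t₀ t₁ h01 A φ G K hA hφ hG hK pA pφ pG pK hpos hheat heq
  rcases h01.eq_or_lt with rfl | h01
  · simp
  have cK := hK.continuousOn
  have cφ := hφ.continuous
  have cG := hG.continuous
  have cD' : ∀ j, Continuous (cD A j φ) := fun j => (cD_cd hA hφ j).continuous
  have hφo : ContDiffOn ℝ (⊤ : ℕ∞) φ (Set.Iio t₁ ×ˢ Set.univ) := hφ.contDiffOn
  have hen : ContDiffOn ℝ (⊤ : ℕ∞) (fun z => K z * ‖φ z‖ ^ 2) (Set.Iio t₁ ×ˢ Set.univ) :=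
    hK.mul (hφ.norm_sq ℝ).contDiffOn
  have hfl : ∀ j, ContDiffOn ℝ (⊤ : ℕ∞) (flux A φ K j) (Set.Iio t₁ ×ˢ Set.univ) := fun j =>
    (hK.mul (contDiff_const.mul (hφ.inner ℝ (cD_cd hA hφ j))).contDiffOn).sub
      ((hφ.inner ℝ hφ).contDiffOn.mul (fderiv_cdo hK _))
  have pfl : ∀ j, Per (flux A φ K j) := by
    intro j z k
    have h1 := Per.cD pA pφ j z k
    have h2 := Per.pd pK j z k
    simp only [flux, pφ z k, pK z k, h1, h2]
  have cd : ContinuousOn (fun z => K z * ∑ j : Fin 2, ‖cD A j φ z‖ ^ 2)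
      (Set.Iio t₁ ×ˢ Set.univ) := cK.mul (by fun_prop)
  have cg : ContinuousOn (fun z => K z * ‖G z‖ ^ 2) (Set.Iio t₁ ×ˢ Set.univ) :=
    cK.mul (by fun_prop)
  have ci : ContinuousOn (fun z => K z * inner ℝ (φ z) (G z)) (Set.Iio t₁ ×ˢ Set.univ) :=
    cK.mul (cφ.inner cG).continuousOn
  obtain ⟨Me, -, hMe⟩ := mass_bound h01 hK pK hpos hheat (f := fun z => ‖φ z‖ ^ 2) (by fun_prop)
  obtain ⟨Md, -, hMd⟩ := mass_bound h01 hK pK hpos hheat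
    (f := fun z => ∑ j : Fin 2, ‖cD A j φ z‖ ^ 2) (by fun_prop)
  obtain ⟨Mg, -, hMg⟩ := mass_bound h01 hK pK hpos hheat (f := fun z => ‖G z‖ ^ 2) (by fun_prop)
  refine real_est (Me := Me) (Md := Md) (Mg := Real.sqrt Mg) h01
    (e := fun t => ∫ x in cell, K (t, x) * ‖φ (t, x)‖ ^ 2)
    (d := fun t => ∫ x in cell, K (t, x) * ∑ j : Fin 2, ‖cD A j φ (t, x)‖ ^ 2)
    (g := fun t => Real.sqrt (∫ x in cell, K (t, x) * ‖G (t, x)‖ ^ 2))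
    (e' := fun t => ∫ x in cell, td (fun z => K z * ‖φ z‖ ^ 2) (t, x))
    (fun t ht => param_deriv hen ht.2)
    (param_cont (f := td (fun z => K z * ‖φ z‖ ^ 2)) (fderiv_cdo hen _).continuousOn)
    (param_cont cd) (param_cont cg).sqrt ?_ ?_ (fun t _ => Real.sqrt_nonneg _) hMe hMd
    (fun t ht => Real.sqrt_le_sqrt (hMg t ht)) ?_
  · exact fun t ht => integral_nonneg fun x => mul_nonneg (hpos (t, x) ht).le (by positivity)
  · exact fun t ht => integral_nonneg fun x => mul_nonneg (hpos (t, x) ht).le (by positivity)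
  · intro t ht
    have hc := cauchy cφ cG cK ht.2 (fun x => hpos (t, x) ht)
    have e : ∀ x, td (fun z => K z * ‖φ z‖ ^ 2) (t, x) =
        (pd 0 (flux A φ K 0) (t, x) + pd 1 (flux A φ K 1) (t, x)) +
        (-2 * (K (t, x) * ∑ j : Fin 2, ‖cD A j φ (t, x)‖ ^ 2) +
        2 * (K (t, x) * inner ℝ (φ (t, x)) (G (t, x)))) := by
      intro x
      rw [td_en hφ hK (z := (t, x)) ht.2, pd_flux hA hφ hK 0 (z := (t, x)) ht.2,
        pd_flux hA hφ hK 1 (z := (t, x)) ht.2, heq (t, x) ⟨ht.1, ht.2.le⟩]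
      have h1 := hheat (t, x) ht
      simp only [lap2, cLap2, Fin.sum_univ_two, inner_add_right] at h1 ⊢
      have h2 : td K (t, x) = - pd 0 (pd 0 K) (t, x) - pd 1 (pd 1 K) (t, x) := by linarith
      rw [h2]
      ring
    have hi : ∀ j, IntegrableOn (fun x => pd j (flux A φ K j) (t, x)) cell := fun j =>
      slice_int (f := pd j (flux A φ K j)) (fderiv_cdo (hfl j) _).continuousOn ht.2
    have k1 : IntegrableOn (fun x => K (t, x) * ∑ j : Fin 2, ‖cD A j φ (t, x)‖ ^ 2) cell :=
      slice_int cd ht.2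
    have k2 : IntegrableOn (fun x => K (t, x) * inner ℝ (φ (t, x)) (G (t, x))) cell :=
      slice_int ci ht.2
    have i1 : IntegrableOn (fun x => pd 0 (flux A φ K 0) (t, x) + pd 1 (flux A φ K 1) (t, x))
      cell := (hi 0).add (hi 1)
    have i2 : IntegrableOn (fun x => -2 * (K (t, x) * ∑ j : Fin 2, ‖cD A j φ (t, x)‖ ^ 2) +
        2 * (K (t, x) * inner ℝ (φ (t, x)) (G (t, x)))) cell :=
      (k1.const_mul _).add (k2.const_mul _)
    simp only [e]
    rw [integral_add i1 i2, integral_add (hi 0) (hi 1),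
      integral_add (k1.const_mul _) (k2.const_mul _), integral_const_mul, integral_const_mul,
      int_pd (hfl 0) ht.2 (fun x k => pfl 0 (t, x) k),
      int_pd (hfl 1) ht.2 (fun x k => pfl 1 (t, x) k)]
    linarith
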